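/- arXiv:1103.1211 — 2 statements merged into one kernel-verified Lean document; each statement's English description precedes it below -/
import Mathlib

section
/- Let Γ be a connected graph, f a scaling function with decay rate bound: there is λ ∈ (0,1] with f(n+1)/f(n) ≥ λ for all n. Then for any two vertices u, v of Γ, the Floyd metrics satisfy δ_{u,f}(x,y) ≥ λ^{d(u,v)} · δ_{v,f}(x,y) for all vertices x, y. -/
/-- A sequence decaying at most by the factor `lam` at each step decays at most by `lam ^ n`
over `n` steps. -/
theorem pow_mul_le_of_forall_mul_le_succ {f : ℕ → ℝ} {lam : ℝ} (hlam : 0 ≤ lam)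
    (hf : ∀ n, lam * f n ≤ f (n + 1)) (m n : ℕ) : lam ^ n * f m ≤ f (m + n) := by
  induction n with
  | zero => simp
  | succ n ih =>
    calc lam ^ (n + 1) * f m = lam * (lam ^ n * f m) := by ring
      _ ≤ lam * f (m + n) := by gcongr
      _ ≤ f (m + (n + 1)) := hf (m + n)

/-- For a scaling function f with decay rate bound λ, the Floyd
metrics based at two vertices u, v satisfy δ_u(x,y) ≥ λ^{d(u,v)} · δ_v(x,y). -/
theorem floyd_metric_basepoint_change
    {A : Type*} (Γ : SimpleGraph A) (hconn : Γ.Connected)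
    (f : ℕ → ℝ) (hf_pos : ∀ n, 0 < f n) (hf_anti : ∀ n, f (n + 1) ≤ f n)
    (lam : ℝ) (hlam0 : 0 < lam) (hlam1 : lam ≤ 1)
    (hdecay : ∀ n, lam * f n ≤ f (n + 1))
    (u v : A)
    -- δu is the Floyd metric based at u: the maximal metric bounded by f on edges
    (δu : A → A → ℝ)
    (hu_self : ∀ x, δu x x = 0) (hu_symm : ∀ x y, δu x y = δu y x)
    (hu_nonneg : ∀ x y, 0 ≤ δu x y) (hu_tri : ∀ x y z, δu x z ≤ δu x y + δu y z)
    (hu_edge : ∀ x y, Γ.Adj x y → δu x y ≤ f (min (Γ.dist u x) (Γ.dist u y)))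
    (hu_max : ∀ ρ : A → A → ℝ, (∀ x, ρ x x = 0) → (∀ x y, ρ x y = ρ y x) →
      (∀ x y, 0 ≤ ρ x y) → (∀ x y z, ρ x z ≤ ρ x y + ρ y z) →
      (∀ x y, Γ.Adj x y → ρ x y ≤ f (min (Γ.dist u x) (Γ.dist u y))) →
      ∀ x y, ρ x y ≤ δu x y)
    -- δv is the Floyd metric based at v
    (δv : A → A → ℝ)
    (hv_self : ∀ x, δv x x = 0) (hv_symm : ∀ x y, δv x y = δv y x)
    (hv_nonneg : ∀ x y, 0 ≤ δv x y) (hv_tri : ∀ x y z, δv x z ≤ δv x y + δv y z)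
    (hv_edge : ∀ x y, Γ.Adj x y → δv x y ≤ f (min (Γ.dist v x) (Γ.dist v y)))
    (hv_max : ∀ ρ : A → A → ℝ, (∀ x, ρ x x = 0) → (∀ x y, ρ x y = ρ y x) →
      (∀ x y, 0 ≤ ρ x y) → (∀ x y z, ρ x z ≤ ρ x y + ρ y z) →
      (∀ x y, Γ.Adj x y → ρ x y ≤ f (min (Γ.dist v x) (Γ.dist v y))) →
      ∀ x y, ρ x y ≤ δv x y) :
    ∀ x y : A, lam ^ (Γ.dist u v) * δv x y ≤ δu x y := by
  have hpow : 0 ≤ lam ^ Γ.dist u v := by positivity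
  refine hu_max (fun x y => lam ^ Γ.dist u v * δv x y) ?_ ?_ ?_ ?_ ?_
  · intro x
    simp [hv_self]
  · intro x y
    simp only [hv_symm x y]
  · intro x y
    exact mul_nonneg hpow (hv_nonneg x y)
  · intro x y z
    rw [← mul_add]
    exact mul_le_mul_of_nonneg_left (hv_tri x y z) hpow
  · intro x y hxy
    have hle : min (Γ.dist u x) (Γ.dist u y) ≤
        min (Γ.dist v x) (Γ.dist v y) + Γ.dist u v := by
      have hx : Γ.dist u x ≤ Γ.dist u v + Γ.dist v x := hconn.dist_triangle
      have hy : Γ.dist u y ≤ Γ.dist u v + Γ.dist v y := hconn.dist_triangle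
      omega
    calc lam ^ Γ.dist u v * δv x y
        ≤ lam ^ Γ.dist u v * f (min (Γ.dist v x) (Γ.dist v y)) :=
          mul_le_mul_of_nonneg_left (hv_edge x y hxy) hpow
      _ ≤ f (min (Γ.dist v x) (Γ.dist v y) + Γ.dist u v) :=
          pow_mul_le_of_forall_mul_le_succ hlam0.le hdecay _ _
      _ ≤ f (min (Γ.dist u x) (Γ.dist u y)) := antitone_nat_of_succ_le hf_anti hle
end

section
/- Let G act 3-discontinuously on a compactum X̃ = T ⊔ A with A discrete and G-finite, and fix a connected locally finite G-graph Γ with Γ⁰ = A. Let H ≤ G be a subgroup and F ⊆ A an H-orbit. If for every ε > 0 there exists r(ε) < ∞ with V_ε(F) := { a ∈ A : diam_{δ̄_a}(F̄) ≥ ε } ⊆ N_{r(ε)}^d(F) (visible quasiconvexity of F), then H is dynamically quasiconvex, and conversely. -/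
/-- The limit set of a subgroup H: points p such that some orbit accumulates at p. -/
def limitSet (G : Type*) {X : Type*} [Group G] [MulAction G X] [TopologicalSpace X]
    (H : Subgroup G) : Set X :=
  {p : X | ∃ y : X, ∀ U ∈ nhds p, {h : H | (h : G) • y ∈ U}.Infinite}

open Filter Topology

section TripleDiscontinuousActions

variable {G X : Type*} [Group G] [TopologicalSpace X] [MulAction G X]

/-- The action of `G` on `X` is properly discontinuous on triples of distinct points. -/
def IsTripleDiscontinuous (G X : Type*) [Group G] [TopologicalSpace X] [MulAction G X] : Prop :=
  ∀ K L : Set (X × X × X), IsCompact K → IsCompact L →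
    (∀ p ∈ K ∪ L, p.1 ≠ p.2.1 ∧ p.1 ≠ p.2.2 ∧ p.2.1 ≠ p.2.2) →
    {g : G | ∃ p ∈ K, (g • p.1, g • p.2.1, g • p.2.2) ∈ L}.Finite

theorem Ultrafilter.exists_tendsto_nhds [CompactSpace X] {ι : Type*} (l : Ultrafilter ι)
    (x : ι → X) : ∃ y, Tendsto x l (𝓝 y) := by
  obtain ⟨y, -, hy⟩ := isCompact_univ.ultrafilter_le_nhds (l.map x) (by simp)
  exact ⟨y, hy⟩

instance Filter.curry_neBot {α β : Type*} {l : Filter α} {m : Filter β} [l.NeBot] [m.NeBot] :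
    (l.curry m).NeBot :=
  neBot_iff.mpr fun h => by
    have h' : ∅ ∈ l.curry m := empty_mem_iff_bot.mpr h
    simp [mem_curry_iff, NeBot.ne] at h'

theorem Filter.Tendsto.not_eventually_mem_of_finite {α ι : Type*} {l : Filter ι} [l.NeBot]
    {g : ι → α} (hg : Tendsto g l cofinite) {S : Set α} (hS : S.Finite) :
    ¬ ∀ᶠ i in l, g i ∈ S := fun h => by
  obtain ⟨i, hi, hi'⟩ := (h.and (hg hS.compl_mem_cofinite)).exists
  exact hi' hi

theorem exists_isCompact_mem_nhds_distinct [CompactSpace X] [T2Space X] {x y z : X}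
    (hxy : x ≠ y) (hxz : x ≠ z) (hyz : y ≠ z) :
    ∃ K ∈ 𝓝 (x, y, z), IsCompact K ∧
      ∀ p ∈ K, p.1 ≠ p.2.1 ∧ p.1 ≠ p.2.2 ∧ p.2.1 ≠ p.2.2 := by
  have hD : IsOpen {p : X × X × X | p.1 ≠ p.2.1 ∧ p.1 ≠ p.2.2 ∧ p.2.1 ≠ p.2.2} :=
    (isOpen_ne_fun (by fun_prop) (by fun_prop)).inter
      ((isOpen_ne_fun (by fun_prop) (by fun_prop)).inter
        (isOpen_ne_fun (by fun_prop) (by fun_prop)))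
  obtain ⟨K, hK, hKD, hKc⟩ := local_compact_nhds (hD.mem_nhds (x := (x, y, z)) ⟨hxy, hxz, hyz⟩)
  exact ⟨K, hK, hKc, fun p hp => hKD hp⟩

theorem IsTripleDiscontinuous.not_tendsto_cofinite [CompactSpace X] [T2Space X]
    (h3 : IsTripleDiscontinuous G X) {ι : Type*} {l : Filter ι} [l.NeBot] {g : ι → G}
    {x y z : ι → X} {x' y' z' x'' y'' z'' : X}
    (hx : Tendsto x l (𝓝 x')) (hy : Tendsto y l (𝓝 y')) (hz : Tendsto z l (𝓝 z'))
    (hgx : Tendsto (fun i => g i • x i) l (𝓝 x'')) (hgy : Tendsto (fun i => g i • y i) l (𝓝 y''))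
    (hgz : Tendsto (fun i => g i • z i) l (𝓝 z''))
    (hxy : x' ≠ y') (hxz : x' ≠ z') (hyz : y' ≠ z')
    (hgxy : x'' ≠ y'') (hgxz : x'' ≠ z'') (hgyz : y'' ≠ z'') :
    ¬ Tendsto g l cofinite := fun hg => by
  obtain ⟨K, hK, hKc, hKD⟩ := exists_isCompact_mem_nhds_distinct hxy hxz hyz
  obtain ⟨L, hL, hLc, hLD⟩ := exists_isCompact_mem_nhds_distinct hgxy hgxz hgyz
  refine hg.not_eventually_mem_of_finite
    (h3 K L hKc hLc fun p hp => hp.elim (hKD p) (hLD p)) ?_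
  filter_upwards [(hx.prodMk_nhds (hy.prodMk_nhds hz)) hK,
    (hgx.prodMk_nhds (hgy.prodMk_nhds hgz)) hL] with i hi hi'
  exact ⟨_, hi, hi'⟩

theorem Filter.Tendsto.ne_smul_of_isOpen_singleton [ContinuousConstSMul G X] {x₀ : X}
    (hopen : IsOpen {x₀}) (hstab : {g : G | g • x₀ = x₀}.Finite) {ι : Type*} {l : Filter ι}
    [l.NeBot] {g : ι → G} (hg : Tendsto g l cofinite) {p : X}
    (hp : Tendsto (fun i => g i • x₀) l (𝓝 p)) (γ : G) : p ≠ γ • x₀ := by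
  rintro rfl
  have hp' : Tendsto (fun i => γ⁻¹ • g i • x₀) l (𝓝 x₀) := by simpa using hp.const_smul γ⁻¹
  refine hg.not_eventually_mem_of_finite (hstab.image fun s => γ * s) ?_
  filter_upwards [hp' (hopen.mem_nhds rfl)] with i hi
  exact ⟨γ⁻¹ * g i, by simpa [mul_smul] using hi, by simp⟩

theorem Filter.Tendsto.inv_cofinite {ι : Type*} {l : Filter ι} {g : ι → G}
    (hg : Tendsto g l cofinite) : Tendsto (fun i => (g i)⁻¹) l cofinite :=
  inv_injective.tendsto_cofinite.comp hg

/-- The convergence property of a 3-discontinuous action having an isolated point with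
finite stabilizer. -/
theorem IsTripleDiscontinuous.tendsto_smul [CompactSpace X] [T2Space X]
    [ContinuousConstSMul G X] (h3 : IsTripleDiscontinuous G X) {x₀ : X}
    (hopen : IsOpen {x₀}) (hstab : {g : G | g • x₀ = x₀}.Finite) {ι : Type*}
    {l : Ultrafilter ι} {g : ι → G} (hg : Tendsto g l cofinite) {p r : X}
    (hp : Tendsto (fun i => g i • x₀) l (𝓝 p)) (hr : Tendsto (fun i => (g i)⁻¹ • x₀) l (𝓝 r))
    {x : ι → X} {y : X} (hx : Tendsto x l (𝓝 y)) (hy : y ≠ r) :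
    Tendsto (fun i => g i • x i) l (𝓝 p) := by
  obtain ⟨z, hz⟩ := l.exists_tendsto_nhds fun i => g i • x i
  by_cases hzp : z = p
  · exact hzp ▸ hz
  have hpx : p ≠ x₀ := by simpa using hg.ne_smul_of_isOpen_singleton hopen hstab hp 1
  have hrx : r ≠ x₀ := by
    simpa using hg.inv_cofinite.ne_smul_of_isOpen_singleton hopen hstab hr 1
  have hyx : y ≠ x₀ := by
    rintro rfl
    refine hzp (tendsto_nhds_unique hz (hp.congr' ?_))
    filter_upwards [hx (hopen.mem_nhds rfl)] with i hi
    rw [show x i = _ from hi]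
  have hzx : z ≠ x₀ := by
    rintro rfl
    refine hy (tendsto_nhds_unique hx (hr.congr' ?_))
    filter_upwards [hz (hopen.mem_nhds rfl)] with i hi
    rw [← show g i • x i = _ from hi, inv_smul_smul]
  refine absurd hg (h3.not_tendsto_cofinite hx (tendsto_const_nhds (x := x₀)) hr hz hp
    (z'' := x₀) ?_ hyx hy hrx.symm hzp hzx hpx)
  simp

theorem mem_limitSet_of_tendsto {H : Subgroup G} {ι : Type*} {l : Filter ι} [l.NeBot]
    {k : ι → G} (hkH : ∀ i, k i ∈ H) (hk : Tendsto k l cofinite) {y p : X}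
    (hp : Tendsto (fun i => k i • y) l (𝓝 p)) : p ∈ limitSet G H := by
  refine ⟨y, fun U hU hfin => hk.not_eventually_mem_of_finite (hfin.image Subtype.val) ?_⟩
  filter_upwards [hp hU] with i hi
  exact ⟨⟨k i, hkH i⟩, hi, rfl⟩

theorem smul_mem_limitSet [ContinuousConstSMul G X] {H : Subgroup G} {k : G} (hk : k ∈ H)
    {p : X} (hp : p ∈ limitSet G H) : k • p ∈ limitSet G H := by
  obtain ⟨y, hy⟩ := hp
  refine ⟨y, fun U hU => ?_⟩
  have hU' : (fun x => k • x) ⁻¹' U ∈ 𝓝 p := (continuous_const_smul k).continuousAt hU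
  refine ((hy _ hU').image (mul_right_injective (⟨k, hk⟩ : H)).injOn).mono ?_
  rintro _ ⟨h, hh, rfl⟩
  simpa [mul_smul] using hh

theorem limitSet_subset_closure_orbit [CompactSpace X] [T2Space X] [ContinuousConstSMul G X]
    (h3 : IsTripleDiscontinuous G X) {x₀ : X} (hopen : IsOpen {x₀})
    (hstab : {g : G | g • x₀ = x₀}.Finite) (H : Subgroup G) :
    limitSet G H ⊆ closure {x | ∃ h ∈ H, h • x₀ = x} := by
  rintro p ⟨y, hy⟩
  have : (comap (fun h : H => (h : G) • y) (𝓝 p) ⊓ cofinite).NeBot := by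
    refine inf_neBot_iff_frequently_left.mpr fun {P} hP => ?_
    obtain ⟨U, hU, hUP⟩ := eventually_comap.mp hP |>.exists_mem
    exact frequently_cofinite_iff_infinite.mpr ((hy U hU).mono fun h hh => hUP _ hh h rfl)
  set l := Ultrafilter.of (comap (fun h : H => (h : G) • y) (𝓝 p) ⊓ cofinite)
  have hl := Ultrafilter.of_le (comap (fun h : H => (h : G) • y) (𝓝 p) ⊓ cofinite)
  have hyp : Tendsto (fun h : H => (h : G) • y) l (𝓝 p) :=
    tendsto_comap.mono_left (hl.trans inf_le_left)
  have hh : Tendsto (fun h : H => (h : G)) l cofinite :=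
    Subtype.val_injective.tendsto_cofinite.mono_left (hl.trans inf_le_right)
  obtain ⟨a, ha⟩ := l.exists_tendsto_nhds fun h : H => (h : G) • x₀
  obtain ⟨r, hr⟩ := l.exists_tendsto_nhds fun h : H => (h : G)⁻¹ • x₀
  by_cases hyr : y = r
  · have hrc : r ∈ closure {x | ∃ h ∈ H, h • x₀ = x} :=
      mem_closure_of_tendsto hr (.of_forall fun h => ⟨_, H.inv_mem h.2, rfl⟩)
    refine isClosed_closure.mem_of_tendsto hyp (.of_forall fun k => ?_)
    rw [hyr]
    refine map_mem_closure (continuous_const_smul (k : G)) hrc ?_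
    rintro _ ⟨h, hh, rfl⟩
    exact ⟨k * h, H.mul_mem k.2 hh, mul_smul _ _ _⟩
  · rw [tendsto_nhds_unique hyp
      (h3.tendsto_smul hopen hstab hh ha hr tendsto_const_nhds hyr)]
    exact mem_closure_of_tendsto ha (.of_forall fun h => ⟨_, h.2, rfl⟩)

/-- No conjugate of an element of a subgroup with a single limit point `q` pushes the complement
of a neighbourhood of the corresponding translate of `q` into a disjoint set. -/
theorem exists_conj_smul_notMem_of_limitSet_eq_singleton [CompactSpace X]
    [ContinuousConstSMul G X] {H : Subgroup G} {q : X} (hq : limitSet G H = {q}) {h g : G}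
    (hh : h ∈ H) {x₀ : X} {M N : Set X} (hMN : Disjoint M N) (hM : M ∈ 𝓝 (g • q))
    (hxM : x₀ ∉ M) (hxN : x₀ ∉ N) : ∃ x, x ∉ M ∧ (g * h * g⁻¹) • x ∉ N := by
  by_contra! hmap
  have hpow : ∀ j : ℕ, (g * h * g⁻¹) ^ (j + 1) • x₀ ∈ N := by
    intro j
    induction j with
    | zero => simpa using hmap x₀ hxM
    | succ j ih =>
      rw [pow_succ', mul_smul]
      exact hmap _ (hMN.notMem_of_mem_right ih)
  by_cases hfin : IsOfFinOrder h
  · obtain ⟨m, hm, hm1⟩ := isOfFinOrder_iff_pow_eq_one.mp hfin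
    obtain ⟨j, rfl⟩ := Nat.exists_eq_add_of_lt hm
    have := hpow j
    rw [conj_pow] at this
    simp only [zero_add] at hm1
    simp [hm1, hxN] at this
  · have hinj : Function.Injective fun j : ℕ => h ^ (j + 1) := fun i j hij => by
      simpa using (injective_pow_iff_not_isOfFinOrder.mpr hfin) hij
    obtain ⟨z, hz⟩ := (hyperfilter ℕ).exists_tendsto_nhds fun j => h ^ (j + 1) • g⁻¹ • x₀
    have hzq : z ∈ limitSet G H := mem_limitSet_of_tendsto (fun j => H.pow_mem hh (j + 1))
      (hinj.tendsto_cofinite.mono_left (hyperfilter_le_cofinite)) hz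
    rw [hq] at hzq
    obtain rfl : z = q := hzq
    obtain ⟨j, hj⟩ := ((hz.const_smul g).eventually_mem hM).exists
    have := hpow j
    rw [conj_pow] at this
    exact hMN.notMem_of_mem_right this (by simpa [mul_smul] using hj)

/-- The limit point of an infinite subgroup with a single limit point is not conical. -/
theorem IsTripleDiscontinuous.tendsto_smul_of_limitSet_eq_singleton [CompactSpace X] [T2Space X]
    [ContinuousConstSMul G X] (h3 : IsTripleDiscontinuous G X) {x₀ : X}
    (hopen : IsOpen {x₀}) (hstab : {g : G | g • x₀ = x₀}.Finite) {H : Subgroup G}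
    [Infinite H] {q : X} (hq : limitSet G H = {q}) {ι : Type*}
    {l : Ultrafilter ι} {g : ι → G} (hg : Tendsto g l cofinite) {p : X}
    (hp : Tendsto (fun i => g i • x₀) l (𝓝 p)) : Tendsto (fun i => g i • q) l (𝓝 p) := by
  have hqfix : ∀ h ∈ H, h • q = q := fun h hh => by
    have := smul_mem_limitSet hh (hq.symm ▸ rfl : q ∈ limitSet G H)
    rwa [hq] at this
  have hqorb : ∀ γ : G, q ≠ γ • x₀ := by
    have hval := (Subtype.val_injective (p := (· ∈ H))).tendsto_cofinite.mono_left
      (hyperfilter_le_cofinite (α := H))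
    obtain ⟨z, hz⟩ := (hyperfilter H).exists_tendsto_nhds fun h => (h : G) • x₀
    have hzq := mem_limitSet_of_tendsto (fun h : H => h.2) hval hz
    rw [hq] at hzq
    obtain rfl : z = q := hzq
    exact hval.ne_smul_of_isOpen_singleton hopen hstab hz
  obtain ⟨c, hc⟩ := l.exists_tendsto_nhds fun i => g i • q
  obtain ⟨r, hr⟩ := l.exists_tendsto_nhds fun i => (g i)⁻¹ • x₀
  by_cases hcp : c = p
  · exact hcp ▸ hc
  obtain rfl : q = r := by
    by_contra hqr
    exact hcp (tendsto_nhds_unique hc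
      (h3.tendsto_smul hopen hstab hg hp hr tendsto_const_nhds hqr))
  have hpx : p ≠ x₀ := by simpa using hg.ne_smul_of_isOpen_singleton hopen hstab hp 1
  have hcx : c ≠ x₀ := by
    rintro rfl
    obtain ⟨i, hi⟩ := (hc.eventually (hopen.mem_nhds rfl)).exists
    exact hqorb (g i)⁻¹ (by rw [← show g i • q = _ from hi, inv_smul_smul])
  obtain ⟨M, N, hM, hN, hMN, hxM, hxN⟩ : ∃ M N : Set X, M ∈ 𝓝 c ∧ N ∈ 𝓝 p ∧ Disjoint M N ∧
      x₀ ∉ M ∧ x₀ ∉ N := by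
    obtain ⟨M, N, hMo, hNo, hcM, hpN, hMN⟩ := t2_separation hcp
    exact ⟨M \ {x₀}, N \ {x₀}, inter_mem (hMo.mem_nhds hcM) (isOpen_ne.mem_nhds hcx),
      inter_mem (hNo.mem_nhds hpN) (isOpen_ne.mem_nhds hpx),
      hMN.mono Set.sdiff_subset Set.sdiff_subset, by simp, by simp⟩
  obtain ⟨m, hmL⟩ : ∃ m : Ultrafilter (H × ι),
      (m : Filter (H × ι)) ≤ (cofinite : Filter H).curry l :=
    Ultrafilter.exists_le _
  have hsnd : Tendsto Prod.snd (m : Filter (H × ι)) l :=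
    tendsto_snd.mono_left (hmL.trans curry_le_prod)
  set f : H × ι → G := fun j => g j.2 * j.1 * (g j.2)⁻¹ with hf
  have hfm : Tendsto f m cofinite := by
    refine Tendsto.mono_left (le_cofinite_iff_eventually_ne.mpr fun γ => ?_) hmL
    rw [eventually_map, eventually_curry_iff]
    have hsub : {h : H | ∀ᶠ i in l, f (h, i) = γ}.Subsingleton := fun h hh h' hh' => by
      obtain ⟨i, hi, hi'⟩ := (hh.and hh').exists
      simpa [hf] using hi.trans hi'.symm
    filter_upwards [hsub.finite.compl_mem_cofinite] with h hh
    exact Ultrafilter.eventually_not.mpr hh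
  have hcm : Tendsto (fun j : H × ι => g j.2 • q) m (𝓝 c) := hc.comp hsnd
  have hpm : Tendsto (fun j : H × ι => g j.2 • x₀) m (𝓝 p) := hp.comp hsnd
  have hpm' : Tendsto (fun j : H × ι => g j.2 • (j.1 : G) • x₀) m (𝓝 p) := by
    refine Tendsto.mono_left
      (fun s hs => mem_map.mpr (mem_curry_iff.mpr (.of_forall fun h => ?_))) hmL
    exact h3.tendsto_smul hopen hstab hg hp hr (tendsto_const_nhds (x := (h : G) • x₀))
      (hqorb h).symm hs
  obtain ⟨ψ, hψH, hψ⟩ : ∃ ψ : H × ι → G, (∀ j, ψ j ∈ H) ∧ ∀ x : H × ι → X, ∀ y,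
      Tendsto x m (𝓝 y) → y ≠ c →
        Tendsto (fun j => (g j.2 * ψ j * (g j.2)⁻¹) • x j) m (𝓝 p) := by
    obtain ⟨a, ha⟩ := m.exists_tendsto_nhds fun j => f j • x₀
    obtain ⟨b, hb⟩ := m.exists_tendsto_nhds fun j => (f j)⁻¹ • x₀
    by_cases hbc : b = c
    · subst hbc
      refine ⟨fun j => j.1, fun j => j.1.2, fun x y hx hy => ?_⟩
      have := h3.tendsto_smul hopen hstab hfm ha hb hpm (Ne.symm hcp)
      simp only [hf, mul_smul, inv_smul_smul] at this
      rw [tendsto_nhds_unique hpm' this]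
      exact h3.tendsto_smul hopen hstab hfm ha hb hx hy
    · have hac := h3.tendsto_smul hopen hstab hfm ha hb hcm (Ne.symm hbc)
      simp only [hf, mul_smul, inv_smul_smul, hqfix _ (Subtype.prop _)] at hac
      obtain rfl := tendsto_nhds_unique hcm hac
      refine ⟨fun j => (j.1 : G)⁻¹, fun j => H.inv_mem j.1.2, fun x y hx hy => ?_⟩
      have hfi := hfm.inv_cofinite
      have ha' : Tendsto (fun j => (f j)⁻¹⁻¹ • x₀) m (𝓝 c) := by simpa using ha
      have := h3.tendsto_smul hopen hstab hfi hb ha' hpm' (Ne.symm hcp)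
      simp only [hf, mul_inv_rev, inv_inv, mul_smul, inv_smul_smul] at this
      rw [tendsto_nhds_unique hpm this]
      simpa [hf, mul_assoc] using h3.tendsto_smul hopen hstab hfi hb ha' hx hy
  have hex : ∀ᶠ j in (m : Filter (H × ι)), ∃ x, x ∉ M ∧ (g j.2 * ψ j * (g j.2)⁻¹) • x ∉ N := by
    filter_upwards [hcm (eventually_mem_nhds_iff.mpr hM)] with j hj
    exact exists_conj_smul_notMem_of_limitSet_eq_singleton hq (hψH j) hMN hj hxM hxN
  have : Nonempty X := ⟨x₀⟩
  obtain ⟨x, hx⟩ := hex.choice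
  obtain ⟨y, hy⟩ := m.exists_tendsto_nhds x
  by_cases hyc : y = c
  · obtain ⟨j, hj, hj'⟩ := (hx.and (hy.eventually (hyc ▸ hM))).exists
    exact absurd hj' hj.1
  · obtain ⟨j, hj, hj'⟩ := (hx.and ((hψ x y hy hyc).eventually hN)).exists
    exact absurd hj' hj.2

/-- If two translates of an orbit point under a coset `g i * H` converge to different points, then
the translates of the limit set do not become small. -/
theorem IsTripleDiscontinuous.exists_nhdsSet_diagonal_eventually_not_subset [CompactSpace X]
    [T2Space X] [ContinuousConstSMul G X] (h3 : IsTripleDiscontinuous G X) {x₀ : X}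
    (hopen : IsOpen {x₀}) (hstab : {g : G | g • x₀ = x₀}.Finite) {H : Subgroup G} {ι : Type*}
    {l : Ultrafilter ι} {g k : ι → G} (hkH : ∀ i, k i ∈ H) (hg : Tendsto g l cofinite)
    (hgk : Tendsto (fun i => g i * k i) l cofinite) {c d : X}
    (hc : Tendsto (fun i => g i • x₀) l (𝓝 c))
    (hd : Tendsto (fun i => (g i * k i) • x₀) l (𝓝 d)) (hcd : c ≠ d) :
    ∃ u ∈ nhdsSet (Set.diagonal X), ∀ᶠ i in l,
      ¬ (((fun x => g i • x) '' limitSet G H) ×ˢ ((fun x => g i • x) '' limitSet G H) ⊆ u) := by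
  obtain ⟨q, hq⟩ := l.exists_tendsto_nhds fun i => (g i)⁻¹ • x₀
  obtain ⟨q', hq'⟩ := l.exists_tendsto_nhds fun i => (g i * k i)⁻¹ • x₀
  have horb : ∀ γ : G, γ • x₀ ≠ q := fun γ =>
    (hg.inv_cofinite.ne_smul_of_isOpen_singleton hopen hstab hq γ).symm
  have hk : Tendsto k l cofinite := by
    refine le_cofinite_iff_eventually_ne.mpr fun γ => ?_
    rw [eventually_map]
    refine Ultrafilter.eventually_not.mpr fun hγ => hcd ?_
    refine tendsto_nhds_unique (h3.tendsto_smul hopen hstab hg hc hq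
      (tendsto_const_nhds (x := γ • x₀)) (horb γ)) (hd.congr' ?_)
    filter_upwards [hγ] with i hi
    rw [mul_smul, hi]
  have hkq : Tendsto (fun i => k i • x₀) l (𝓝 q) := by
    obtain ⟨z, hz⟩ := l.exists_tendsto_nhds fun i => k i • x₀
    by_cases hzq : z = q
    · exact hzq ▸ hz
    · have := h3.tendsto_smul hopen hstab hg hc hq hz hzq
      simp only [← mul_smul] at this
      exact absurd (tendsto_nhds_unique this hd) hcd
  have hkq' : Tendsto (fun i => (k i)⁻¹ • x₀) l (𝓝 q') := by
    obtain ⟨z, hz⟩ := l.exists_tendsto_nhds fun i => (k i)⁻¹ • x₀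
    by_cases hzq : z = q'
    · exact hzq ▸ hz
    · have := h3.tendsto_smul hopen hstab hgk hd hq' hz hzq
      simp only [← mul_smul, mul_inv_cancel_right] at this
      exact absurd (tendsto_nhds_unique hc this) hcd
  have hqΛ : q ∈ limitSet G H := mem_limitSet_of_tendsto hkH hk hkq
  have hqΛ' : q' ∈ limitSet G H :=
    mem_limitSet_of_tendsto (fun i => H.inv_mem (hkH i)) hk.inv_cofinite hkq'
  obtain ⟨y, hy, z, hz, hyc, hzd⟩ : ∃ y ∈ limitSet G H, ∃ z ∈ limitSet G H,
      Tendsto (fun i => g i • y) l (𝓝 c) ∧ Tendsto (fun i => (g i * k i) • z) l (𝓝 d) := by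
    by_cases hΛ : limitSet G H = {q}
    · obtain rfl : q' = q := by rwa [hΛ] at hqΛ'
      have : Infinite H := by
        refine Set.infinite_coe_iff (s := (H : Set G)).mpr fun hfin => ?_
        exact hk.not_eventually_mem_of_finite (S := H) hfin (.of_forall hkH)
      exact ⟨q', hqΛ, q', hqΛ, h3.tendsto_smul_of_limitSet_eq_singleton hopen hstab hΛ hg hc,
        h3.tendsto_smul_of_limitSet_eq_singleton hopen hstab hΛ hgk hd⟩
    · have hnt : (limitSet G H : Set X).Nontrivial := by
        by_contra hsub
        exact hΛ ((Set.not_nontrivial_iff.mp hsub).eq_singleton_of_mem hqΛ)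
      obtain ⟨y, hy, hyq⟩ := hnt.exists_ne q
      obtain ⟨z, hz, hzq⟩ := hnt.exists_ne q'
      exact ⟨y, hy, z, hz, h3.tendsto_smul hopen hstab hg hc hq tendsto_const_nhds hyq,
        h3.tendsto_smul hopen hstab hgk hd hq' tendsto_const_nhds hzq⟩
  obtain ⟨U, -, M, hM, V, -, N, hN, hMc, hNc, -, -, hMU, hNV, hUV⟩ := disjoint_nested_nhds hcd
  have hMN : Disjoint M N := hUV.mono hMU hNV
  refine ⟨(M ×ˢ N)ᶜ, (hMc.prod hNc).isOpen_compl.mem_nhdsSet.mpr ?_, ?_⟩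
  · rintro ⟨a, b⟩ (rfl : a = b) ⟨ha, hb⟩
    exact hMN.notMem_of_mem_left ha hb
  · filter_upwards [hyc hM, hzd hN] with i hi hi' hsub
    have hmem : (g i • y, (g i * k i) • z) ∈ ((fun x => g i • x) '' limitSet G H) ×ˢ
        ((fun x => g i • x) '' limitSet G H) :=
      ⟨⟨y, hy, rfl⟩, ⟨k i • z, smul_mem_limitSet (hkH i) hz, smul_smul _ _ _⟩⟩
    exact hsub hmem ⟨hi, hi'⟩

end TripleDiscontinuousActions

namespace SimpleGraph

variable {V W : Type*}

theorem Connected.dist_map_le {Γ : SimpleGraph V} {Γ' : SimpleGraph W} (hΓ : Γ.Connected)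
    (f : Γ →g Γ') (x y : V) : Γ'.dist (f x) (f y) ≤ Γ.dist x y := by
  obtain ⟨p, hp⟩ := hΓ.exists_walk_length_eq_dist x y
  simpa [hp] using dist_le (p.map f)

theorem Connected.finite_setOf_dist_le {Γ : SimpleGraph V} (hΓ : Γ.Connected)
    (hloc : Γ.LocallyFinite) (a : V) (r : ℕ) : {v | Γ.dist v a ≤ r}.Finite := by
  induction r with
  | zero =>
    refine (Set.finite_singleton a).subset fun v hv => ?_
    exact hΓ.dist_eq_zero_iff.mp (Nat.le_zero.mp hv)
  | succ r ih =>
    refine (ih.union (ih.biUnion fun w _ => @Set.toFinite _ (Γ.neighborSet w)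
      (@Finite.of_fintype _ (hloc w)))).subset fun v hv => ?_
    obtain ⟨p, hp⟩ := hΓ.exists_walk_length_eq_dist v a
    cases p with
    | nil => exact Or.inl (by simp)
    | cons hadj p =>
      refine Or.inr (Set.mem_biUnion (x := _) ?_ hadj.symm)
      have hv' : Γ.dist v a ≤ r + 1 := hv
      have := dist_le p
      simp only [Walk.length_cons] at hp
      simp only [Set.mem_ofPred_eq]
      omega

end SimpleGraph
/-- For a 3-discontinuous action of G on X̃ = T ⊔ A with A discrete
and G-finite, carrying a connected locally finite G-graph Γ, and an H-orbit F ⊆ A: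
F is visibly quasiconvex (∀ ε > 0 ∃ r, V_ε(F) ⊆ N_r(F)) if and only if H is
dynamically quasiconvex. -/
theorem visible_iff_dynamical_quasiconvexity
    {G X : Type*} [Group G] [TopologicalSpace X] [CompactSpace X] [T2Space X]
    [MulAction G X] (hcont : ∀ g : G, Continuous fun x : X => g • x)
    -- the action is 3-discontinuous: properly discontinuous on distinct triples
    (h3disc : ∀ K L : Set (X × X × X), IsCompact K → IsCompact L →
      (∀ p ∈ K ∪ L, p.1 ≠ p.2.1 ∧ p.1 ≠ p.2.2 ∧ p.2.1 ≠ p.2.2) →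
      {g : G | ∃ p ∈ K, (g • p.1, g • p.2.1, g • p.2.2) ∈ L}.Finite)
    -- A: discrete, open, G-invariant, G-finite discontinuity domain
    (A : Set X) (hAopen : IsOpen A) (hAdisc : DiscreteTopology ↥A)
    (hAinv : ∀ g : G, ∀ x ∈ A, g • x ∈ A)
    (hAfin : ∃ F : Finset X, ↑F ⊆ A ∧ ∀ x ∈ A, ∃ g : G, ∃ y ∈ F, g • y = x)
    -- the action of G on A is properly discontinuous
    (hproper : ∀ x y : X, x ∈ A → y ∈ A → {g : G | g • x = y}.Finite)
    -- Γ: connected locally finite G-graph on A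
    (Γ : SimpleGraph ↥A) (hconn : Γ.Connected) (hloc : Γ.LocallyFinite)
    (hΓinv : ∀ (g : G) (x y : ↥A) (hx : g • (x : X) ∈ A) (hy : g • (y : X) ∈ A),
      Γ.Adj x y → Γ.Adj ⟨g • (x : X), hx⟩ ⟨g • (y : X), hy⟩)
    -- the shortcut Floyd metrics δ̄_a on X̃, a ∈ A
    (δ : ↥A → X → X → ℝ)
    (hδ_self : ∀ a x, δ a x x = 0) (hδ_symm : ∀ a x y, δ a x y = δ a y x)
    (hδ_nonneg : ∀ a x y, 0 ≤ δ a x y)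
    (hδ_tri : ∀ a x y z, δ a x z ≤ δ a x y + δ a y z)
    -- equivariance: δ̄_{ga}(x,y) = δ̄_a(g⁻¹x, g⁻¹y)
    (hequi : ∀ (g : G) (a : ↥A) (ha : g • (a : X) ∈ A) (x y : X),
      δ ⟨g • (a : X), ha⟩ x y = δ a (g⁻¹ • x) (g⁻¹ • y))
    -- change of basepoint is bilipschitz
    (hcomp : ∀ a b : ↥A, ∃ C : ℝ, 0 < C ∧ ∀ x y : X, δ a x y ≤ C * δ b x y)
    -- the sets u_ε = { (p,q) : δ̄_a(p,q) < ε } are entourages and generate the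
    -- entourage filter
    (hents : ∀ (a : ↥A) (ε : ℝ), 0 < ε →
      {p : X × X | δ a p.1 p.2 < ε} ∈ nhdsSet (Set.diagonal X))
    (hgen : ∀ u ∈ nhdsSet (Set.diagonal X), ∃ (a : ↥A) (ε : ℝ), 0 < ε ∧
      {p : X × X | δ a p.1 p.2 < ε} ⊆ u)
    -- F is an H-orbit in A
    (H : Subgroup G) (x₀ : ↥A) (F : Set ↥A)
    (hF : F = {x : ↥A | ∃ h : H, (h : G) • (x₀ : X) = (x : X)}) :
    -- visible quasiconvexity of F ↔ dynamical quasiconvexity of H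
    ((∀ ε : ℝ, 0 < ε → ∃ r : ℕ, ∀ v : ↥A,
        (∃ p ∈ closure (Subtype.val '' F), ∃ q ∈ closure (Subtype.val '' F),
          ε ≤ δ v p q) →
        ∃ w ∈ F, Γ.dist v w ≤ r)
      ↔
      (∀ u ∈ nhdsSet (Set.diagonal X), ∃ T : Finset G,
        {g : G | ¬ (((fun x => g • x) '' limitSet G H) ×ˢ
            ((fun x => g • x) '' limitSet G H) ⊆ u)}
          ⊆ ⋃ t ∈ T, (fun h => t * h) '' (H : Set G))) := by
  have : ContinuousConstSMul G X := ⟨hcont⟩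
  have hsing : ∀ a ∈ A, IsOpen {a} := fun a ha => by
    simpa using hAopen.isOpenMap_subtype_val _ (isOpen_discrete {(⟨a, ha⟩ : A)})
  have hopen := hsing x₀ x₀.2
  have hstab : {g : G | g • (x₀ : X) = x₀}.Finite := hproper _ _ x₀.2 x₀.2
  have h3 : IsTripleDiscontinuous G X := h3disc
  have hFimage : Subtype.val '' F = {x : X | ∃ h ∈ H, h • (x₀ : X) = x} := by
    ext x
    constructor
    · rintro ⟨y, hy, rfl⟩
      rw [hF] at hy
      obtain ⟨h, hh⟩ := hy
      exact ⟨h, h.2, hh⟩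
    · rintro ⟨h, hh, rfl⟩
      exact ⟨⟨_, hAinv h x₀ x₀.2⟩, hF ▸ ⟨⟨h, hh⟩, rfl⟩, rfl⟩
  let act : G → A → A := fun g x => ⟨g • (x : X), hAinv g x x.2⟩
  have hdist : ∀ (g : G) (x y : A), Γ.dist (act g x) (act g y) ≤ Γ.dist x y := fun g =>
    hconn.dist_map_le
      (⟨act g, fun {x y} h => hΓinv g x y (hAinv g x x.2) (hAinv g y y.2) h⟩ : Γ →g Γ)
  have hact : ∀ (g g' : G) (x : A), act g (act g' x) = act (g * g') x := fun g g' x =>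
    Subtype.ext (smul_smul g g' (x : X))
  have hact_inv : ∀ (g : G) (x : A), act g⁻¹ (act g x) = x := fun g x =>
    Subtype.ext (inv_smul_smul g (x : X))
  have hδact : ∀ (g : G) (a : A) (x y : X), δ (act g a) x y = δ a (g⁻¹ • x) (g⁻¹ • y) :=
    fun g a => hequi g a (hAinv g a a.2)
  constructor
  · intro hvis u hu
    obtain ⟨a, ε, hε, hsub⟩ := hgen u hu
    obtain ⟨r, hr⟩ := hvis ε hε
    have hS : {s : G | Γ.dist (act s a) x₀ ≤ r}.Finite := by
      refine ((hconn.finite_setOf_dist_le hloc x₀ r).biUnion fun b _ =>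
        hproper a b a.2 b.2).subset fun s hs => ?_
      exact Set.mem_biUnion (x := act s a) hs rfl
    refine ⟨(hS.image fun s => s⁻¹).toFinset, fun g hg => ?_⟩
    obtain ⟨⟨-, -⟩, ⟨⟨p, hp, rfl⟩, ⟨q, hq, rfl⟩⟩, hpq⟩ := Set.not_subset.mp hg
    have hΛ := limitSet_subset_closure_orbit h3 hopen hstab H
    rw [← hFimage] at hΛ
    obtain ⟨w, hw, hwr⟩ := hr (act g⁻¹ a) ⟨p, hΛ hp, q, hΛ hq, by
      rw [hδact, inv_inv]
      exact not_lt.mp fun hlt => hpq (hsub hlt)⟩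
    rw [hF] at hw
    obtain ⟨h, hh⟩ := hw
    obtain rfl : act h x₀ = w := Subtype.ext hh
    have hd := (hdist (h : G)⁻¹ _ _).trans hwr
    rw [hact_inv, hact] at hd
    refine Set.mem_biUnion (x := g * h) ?_ ⟨(h : G)⁻¹, H.inv_mem h.2, by simp⟩
    simp only [Set.Finite.coe_toFinset]
    exact ⟨_, hd, by simp⟩
  · intro hdyn ε hε
    by_contra! hfar
    choose v hv hvF using hfar
    obtain ⟨R, hRA, hR⟩ := hAfin
    have hrep : ∀ n, ∃ γ : G, ∃ a : A, (a : X) ∈ R ∧ act γ a = v n := fun n => by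
      obtain ⟨γ, y, hy, hyv⟩ := hR (v n) (v n).2
      exact ⟨γ, ⟨y, hRA hy⟩, hy, Subtype.ext hyv⟩
    choose γ b hbR hγb using hrep
    have hpts : ∀ n, ∃ s ∈ H, ∃ s' ∈ H, ε / 2 ≤ δ (v n) (s • (x₀ : X)) (s' • (x₀ : X)) := by
      intro n
      obtain ⟨p, hp, q, hq, hpq⟩ := hv n
      have happrox : ∀ p ∈ closure (Subtype.val '' F),
          ∃ s ∈ H, δ (v n) p (s • (x₀ : X)) < ε / 4 := by
        intro p hp
        have hU : {x | δ (v n) p x < ε / 4} ∈ 𝓝 p :=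
          (Continuous.prodMk_right p).continuousAt
            (mem_nhdsSet_iff_forall.mp (hents (v n) (ε / 4) (by positivity)) (p, p) rfl)
        obtain ⟨x, hx, hxF⟩ := mem_closure_iff_nhds.mp hp _ hU
        rw [hFimage] at hxF
        obtain ⟨s, hs, rfl⟩ := hxF
        exact ⟨s, hs, hx⟩
      obtain ⟨s, hs, hps⟩ := happrox p hp
      obtain ⟨s', hs', hqs⟩ := happrox q hq
      refine ⟨s, hs, s', hs', ?_⟩
      have h₁ := hδ_tri (v n) p (s • (x₀ : X)) q
      have h₂ := hδ_tri (v n) (s • (x₀ : X)) (s' • (x₀ : X)) q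
      rw [hδ_symm (v n) (s' • (x₀ : X)) q] at h₂
      linarith
    choose s hs s' hs' hss using hpts
    obtain ⟨a, ha⟩ : ∃ a : A, ∀ᶠ n in (hyperfilter ℕ : Filter ℕ), b n = a := by
      have hfin : {a : A | (a : X) ∈ R}.Finite :=
        R.finite_toSet.preimage Subtype.val_injective.injOn
      obtain ⟨a, -, ha⟩ := (Ultrafilter.eventually_exists_mem_iff hfin
        (P := fun a n => b n = a)).mp (.of_forall fun n => ⟨b n, hbR n, rfl⟩)
      exact ⟨a, ha⟩
    have hfar : ∀ t : G, ∀ᶠ n in (hyperfilter ℕ : Filter ℕ), ∀ h ∈ H, (γ n)⁻¹ * h ≠ t := by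
      intro t
      filter_upwards [ha, (Nat.hyperfilter_le_atTop) (eventually_ge_atTop (Γ.dist a (act t x₀)))]
        with n hn hnr h hh ht
      have hlt := hvF n (act h x₀) (hF ▸ ⟨⟨h, hh⟩, rfl⟩)
      have hle := hdist (γ n) a (act t x₀)
      have hγ : act (γ n) (act t x₀) = act h x₀ := by
        rw [hact, ← ht, mul_inv_cancel_left]
      rw [hγ, ← hn, hγb, hn] at hle
      exact absurd (hlt.trans_le (hle.trans hnr)) (lt_irrefl n)
    have hcof : ∀ h : ℕ → G, (∀ n, h n ∈ H) →
        Tendsto (fun n => (γ n)⁻¹ * h n) (hyperfilter ℕ) cofinite := fun h hh => by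
      refine le_cofinite_iff_eventually_ne.mpr fun t => ?_
      rw [eventually_map]
      filter_upwards [hfar t] with n hn
      exact hn _ (hh n)
    obtain ⟨c, hc⟩ := (hyperfilter ℕ).exists_tendsto_nhds fun n => ((γ n)⁻¹ * s n) • (x₀ : X)
    obtain ⟨d, hd⟩ := (hyperfilter ℕ).exists_tendsto_nhds fun n => ((γ n)⁻¹ * s' n) • (x₀ : X)
    have hcd : c ≠ d := by
      rintro rfl
      have hU := mem_nhdsSet_iff_forall.mp (hents a (ε / 2) (by positivity)) (c, c) rfl
      obtain ⟨n, hn, hna⟩ := (((hc.prodMk_nhds hd).eventually_mem hU).and ha).exists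
      have hle := hss n
      rw [← hγb, hδact, hna, ← mul_smul, ← mul_smul] at hle
      exact absurd (show δ a _ _ < ε / 2 from hn) (not_lt.mpr hle)
    obtain ⟨u, hu, hlarge⟩ := h3.exists_nhdsSet_diagonal_eventually_not_subset hopen hstab
      (k := fun n => (s n)⁻¹ * s' n) (fun n => H.mul_mem (H.inv_mem (hs n)) (hs' n))
      (hcof s hs) (by simpa [mul_assoc] using hcof s' hs') hc (by simpa [mul_assoc] using hd) hcd
    obtain ⟨T, hT⟩ := hdyn u hu
    obtain ⟨n, hn, hnT⟩ := (hlarge.and ((Finset.eventually_all T).mpr fun t _ => hfar t)).exists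
    obtain ⟨t, ht, h, hh, hth⟩ := Set.mem_iUnion₂.mp (hT hn)
    exact hnT t ht (s n * h⁻¹) (H.mul_mem (hs n) (H.inv_mem hh))
      (by rw [← mul_assoc, ← hth, mul_inv_cancel_right])
end
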